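/- Let z_0 < z_1 < ⋯ < z_n be real numbers, let 1 ≤ k ≤ n, and let x = {i_1 < i_2 < ⋯ < i_k} be a k-element subset of {0,1,…,n−1}. Define α ∈ {+1,−1}^n by α_i := (−1)^{|x ∩ {0,…,i−1}|}. For a = (a_1,…,a_k) ∈ ℝ^k let f_a(z) = (−z)^k + a_k z^{k−1} + ⋯ + a_2 z + a_1, and let Δ := {a ∈ ℝ^k : α_i · f_a(z_i) ≥ 0 for all 1 ≤ i ≤ n}. Then the function a ↦ f_a(z_0) attains a maximum on Δ; the maximum value equals the product (z_{i_1 + 1} − z_0)(z_{i_2 + 1} − z_0)⋯(z_{i_k + 1} − z_0); and this maximum is attained at the coefficient vector a of the polynomial ∏_{j=1}^k (z_{i_j + 1} − z). -/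

import Mathlib

open scoped BigOperators

/-- The `j`-th element (in increasing order) of a `k`-element finite set of indices. -/
def enumDots {n k : ℕ} (D : Finset (Fin n)) (h : D.card = k) (j : Fin k) : Fin n :=
  (D.orderIsoOfFin h j).1

/-- `f_a(t) = (−t)^k + a_k t^{k−1} + ⋯ + a_2 t + a_1`. -/
def vandermondeEval (k : ℕ) (a : Fin k → ℝ) (t : ℝ) : ℝ :=
  (-t) ^ k + ∑ j : Fin k, a j * t ^ (j : ℕ)

/-- A product whose factors are nonpositive on `p` and nonnegative off `p` has sign `(-1) ^ m`,
where `m` counts the indices satisfying `p`. -/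
lemma neg_one_pow_card_filter_mul_prod_nonneg {ι : Type*} (s : Finset ι) (p : ι → Prop)
    [DecidablePred p] (f : ι → ℝ) (hneg : ∀ i ∈ s, p i → f i ≤ 0)
    (hpos : ∀ i ∈ s, ¬ p i → 0 ≤ f i) :
    0 ≤ (-1 : ℝ) ^ (s.filter p).card * ∏ i ∈ s, f i := by
  have h : (-1 : ℝ) ^ (s.filter p).card = ∏ i ∈ s, if p i then (-1 : ℝ) else 1 := by
    rw [← Finset.prod_const, Finset.prod_filter]
  rw [h, ← Finset.prod_mul_distrib]
  refine Finset.prod_nonneg fun i hi => ?_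
  by_cases hp : p i
  · simpa [hp] using hneg i hi hp
  · simpa [hp] using hpos i hi hp

lemma prod_enumDots {n k : ℕ} (D : Finset (Fin n)) (h : D.card = k) (F : Fin n → ℝ) :
    ∏ j : Fin k, F (enumDots D h j) = ∏ i ∈ D, F i := by
  rw [← Finset.prod_coe_sort D F]
  exact (D.orderIsoOfFin h).toEquiv.prod_comp fun i : D => F i

open Polynomial in
/-- `∏ i ∈ s, (w i - t)` is of the form `f_a(t)`. -/
lemma exists_vandermondeEval_eq_prod {ι : Type*} (s : Finset ι) (w : ι → ℝ) :
    ∃ a : Fin s.card → ℝ, ∀ t, vandermondeEval s.card a t = ∏ i ∈ s, (w i - t) := by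
  set M : ℝ[X] := ∏ i ∈ s, (X - C (w i)) with hM
  have hmonic : M.Monic := monic_prod_of_monic _ _ fun i _ => monic_X_sub_C _
  have hdeg : M.natDegree = s.card := natDegree_finsetProd_X_sub_C_eq_card s w
  refine ⟨fun j => (-1) ^ s.card * M.coeff j, fun t => ?_⟩
  have hprod : ∏ i ∈ s, (w i - t) = (-1) ^ s.card * M.eval t := by
    rw [hM, eval_prod, ← Finset.prod_const, ← Finset.prod_mul_distrib]
    exact Finset.prod_congr rfl fun i _ => by simp
  have hlead : M.coeff s.card = 1 := hdeg ▸ hmonic.coeff_natDegree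
  rw [hprod, eval_eq_sum_range, hdeg, Finset.sum_range_succ, hlead, Finset.sum_range, mul_add,
    Finset.mul_sum, vandermondeEval, neg_pow t, one_mul, add_comm]
  simp only [mul_assoc]

open Polynomial in
/-- Lagrange interpolation for the difference of two functions `f_a`, `f_b`. -/
lemma vandermondeEval_sub_eq_sum_lagrange {ι : Type*} [DecidableEq ι] (s : Finset ι) (w : ι → ℝ)
    (hw : Set.InjOn w s) (a b : Fin s.card → ℝ) (t : ℝ) :
    vandermondeEval s.card a t - vandermondeEval s.card b t =
      ∑ i ∈ s, (vandermondeEval s.card a (w i) - vandermondeEval s.card b (w i)) *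
        ∏ l ∈ s.erase i, (w i - w l)⁻¹ * (t - w l) := by
  set Q : ℝ[X] := ∑ j : Fin s.card, C (a j - b j) * X ^ (j : ℕ) with hQ
  have heval : ∀ u, Q.eval u = vandermondeEval s.card a u - vandermondeEval s.card b u := by
    intro u
    simp [hQ, eval_finsetSum, vandermondeEval, sub_mul, Finset.sum_sub_distrib]
  have hdeg : Q.degree < s.card := degree_sum_fin_lt fun j => a j - b j
  rw [← heval t]
  conv_lhs => rw [Lagrange.eq_interpolate hw hdeg]
  simp [Lagrange.interpolate_apply, Lagrange.basis, Lagrange.basisDivisor,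
    eval_finsetSum, eval_prod, heval]

/-- Proposition 3.25: let `z_0 < z_1 < ⋯ < z_n`, let `x ⊆ {0,…,n−1}` with
`|x| = k`, let `α` be the associated sign sequence `α_i = (−1)^{|x ∩ {0,…,i−1}|}`, and let
`Δ = Δ_α` be the corresponding region of the left cyclic Vandermonde arrangement. Then the
objective `a ↦ f_a(z_0)` attains its maximum on `Δ` at the coefficient vector of the
polynomial `∏_j (z_{i_j+1} − t)`, and the maximum value is `∏_j (z_{i_j+1} − z_0)`, where
`i_1 < ⋯ < i_k` enumerate `x`. (Here `z : Fin (n+1) → ℝ` with `z ⟨m⟩ = z_m`, and the `i`-th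
hyperplane value is `f_a(z_{i})` for `1 ≤ i ≤ n`.) -/
theorem leftCyclic_vandermonde_objective_max
    (n k : ℕ) (hk1 : 1 ≤ k) (hkn : k ≤ n)
    (z : Fin (n + 1) → ℝ) (hz : StrictMono z)
    (x : Finset (Fin n)) (hx : x.card = k) :
    ∃ a₀ : Fin k → ℝ,
      (∀ t : ℝ, vandermondeEval k a₀ t = ∏ j : Fin k, (z (enumDots x hx j).succ - t)) ∧
      a₀ ∈ {a : Fin k → ℝ | ∀ i : Fin n,
        0 ≤ (-1 : ℝ) ^ ((x.filter fun j => j ≤ i).card) * vandermondeEval k a (z i.succ)} ∧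
      (∀ a ∈ {a : Fin k → ℝ | ∀ i : Fin n,
          0 ≤ (-1 : ℝ) ^ ((x.filter fun j => j ≤ i).card) * vandermondeEval k a (z i.succ)},
        vandermondeEval k a (z 0) ≤ vandermondeEval k a₀ (z 0)) ∧
      vandermondeEval k a₀ (z 0) = ∏ j : Fin k, (z (enumDots x hx j).succ - z 0) := by
  subst hx
  have hsucc : ∀ {i j : Fin n}, i ≤ j → z i.succ ≤ z j.succ := fun h =>
    hz.monotone (Fin.succ_le_succ_iff.2 h)
  obtain ⟨a₀, ha₀⟩ := exists_vandermondeEval_eq_prod x fun i => z i.succ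
  have henum : ∀ t, vandermondeEval x.card a₀ t =
      ∏ j : Fin x.card, (z (enumDots x rfl j).succ - t) := fun t => by
    rw [ha₀, prod_enumDots x rfl fun i => z i.succ - t]
  refine ⟨a₀, henum, fun i => ?_, fun a ha => ?_, henum _⟩
  · rw [ha₀]
    exact neg_one_pow_card_filter_mul_prod_nonneg x (· ≤ i) _
      (fun j _ hj => sub_nonpos.2 (hsucc hj))
      (fun j _ hj => sub_nonneg.2 (hsucc (not_le.1 hj).le))
  · rw [← sub_nonpos, vandermondeEval_sub_eq_sum_lagrange x (fun i => z i.succ)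
      (hz.injective.comp (Fin.succ_injective n)).injOn]
    refine Finset.sum_nonpos fun i hi => ?_
    have hzero : vandermondeEval x.card a₀ (z i.succ) = 0 := by
      rw [ha₀]
      exact Finset.prod_eq_zero hi (sub_self _)
    have hz0 : ∀ l : Fin n, z 0 - z l.succ ≤ 0 := fun l =>
      sub_nonpos.2 (hz.monotone (Fin.zero_le _))
    have hbasis := neg_one_pow_card_filter_mul_prod_nonneg (x.erase i) (· ≤ i)
      (fun l => (z i.succ - z l.succ)⁻¹ * (z 0 - z l.succ))
      (fun l _ hl => mul_nonpos_of_nonneg_of_nonpos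
        (inv_nonneg.2 (sub_nonneg.2 (hsucc hl))) (hz0 l))
      (fun l _ hl => mul_nonneg_of_nonpos_of_nonpos
        (inv_nonpos.2 (sub_nonpos.2 (hsucc (not_le.1 hl).le))) (hz0 l))
    have hcard : (x.filter (· ≤ i)).card = ((x.erase i).filter (· ≤ i)).card + 1 := by
      rw [Finset.filter_erase, Finset.card_erase_add_one (by simp [hi])]
    have hai := ha i
    rw [hcard, pow_succ] at hai
    rw [hzero, sub_zero]
    rcases neg_one_pow_eq_or ℝ ((x.erase i).filter (· ≤ i)).card with h | h <;>
      rw [h] at hai hbasis <;> nlinarith
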